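/- Let d ≥ 1 and let u : ℝᵈ → ℝᵈ be a continuously differentiable vector field with compact support. Then ∫_{ℝᵈ} [ ⟨2𝔻(u)(x)(u(x)), u(x)⟩ + (div u)(x)·‖u(x)‖² ] dx = 0, where 𝔻(u)(x) = (1/2)(Du(x) + Du(x)ᵀ) is the symmetric strain tensor built from the Fréchet derivative Du(x) (with Du(x)ᵀ its Euclidean adjoint), and (div u)(x) = ∑_{i=1}^{d} ∂uᵢ/∂xᵢ(x); equivalently, ∫_{ℝᵈ} [ 2⟨Du(x)(u(x)), u(x)⟩ + (div u)(x)·‖u(x)‖² ] dx = 0. -/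

import Mathlib

open MeasureTheory
open scoped RealInnerProductSpace

/-- The divergence of `g • u` integrates to zero when `u` is a compactly supported `C¹` vector field
and `g` is a `C¹` function. -/
theorem integral_fderiv_apply_add_divergence_mul_eq_zero {ι : Type*} [Fintype ι] [DecidableEq ι]
    {u : EuclideanSpace ℝ ι → EuclideanSpace ℝ ι} {g : EuclideanSpace ℝ ι → ℝ}
    (hu : ContDiff ℝ 1 u) (hus : HasCompactSupport u) (hg : ContDiff ℝ 1 g) :
    ∫ x, (fderiv ℝ g x (u x) +
      (∑ i, fderiv ℝ u x (EuclideanSpace.single i 1) i) * g x) = 0 := by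
  have hDu := hu.continuous_fderiv one_ne_zero
  have hDg := hg.continuous_fderiv one_ne_zero
  have hcoord (i : ι) : ContDiff ℝ 1 (fun x ↦ u x i) := by fun_prop
  have hcoord_supp (i : ι) : HasCompactSupport (fun x ↦ u x i) :=
    hus.comp_left (g := fun v : EuclideanSpace ℝ ι ↦ v i) rfl
  have hcoord_fderiv (i : ι) (x v : EuclideanSpace ℝ ι) :
      fderiv ℝ (fun y ↦ u y i) x v = fderiv ℝ u x v i := by
    have h := (EuclideanSpace.proj i : EuclideanSpace ℝ ι →L[ℝ] ℝ).hasFDerivAt.comp x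
      (hu.differentiable one_ne_zero x).hasFDerivAt
    exact congrArg (fun L : EuclideanSpace ℝ ι →L[ℝ] ℝ ↦ L v) h.fderiv
  have hint₁ (i : ι) : Integrable (fun x ↦ u x i * fderiv ℝ g x (EuclideanSpace.single i 1)) :=
    Continuous.integrable_of_hasCompactSupport (by fun_prop) (hcoord_supp i).mul_right
  have hint₂ (i : ι) : Integrable (fun x ↦ fderiv ℝ u x (EuclideanSpace.single i 1) i * g x) := by
    refine Continuous.integrable_of_hasCompactSupport (by fun_prop) (HasCompactSupport.mul_right ?_)
    simpa only [hcoord_fderiv] using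
      (hcoord_supp i).fderiv_apply (𝕜 := ℝ) (EuclideanSpace.single i 1)
  have hparts (i : ι) : ∫ x, (u x i * fderiv ℝ g x (EuclideanSpace.single i 1) +
      fderiv ℝ u x (EuclideanSpace.single i 1) i * g x) = 0 := by
    rw [integral_add (hint₁ i) (hint₂ i),
      integral_mul_fderiv_eq_neg_fderiv_mul_of_integrable
        (by simpa only [hcoord_fderiv] using hint₂ i) (hint₁ i)
        (Continuous.integrable_of_hasCompactSupport
          ((hcoord i).continuous.mul hg.continuous) (hcoord_supp i).mul_right)
        (fun x _ ↦ (hcoord i).differentiable one_ne_zero x)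
        (fun x _ ↦ hg.differentiable one_ne_zero x)]
    simp only [hcoord_fderiv, neg_add_cancel]
  have hexpand (x : EuclideanSpace ℝ ι) :
      fderiv ℝ g x (u x) = ∑ i, u x i * fderiv ℝ g x (EuclideanSpace.single i 1) := by
    conv_lhs => rw [← (EuclideanSpace.basisFun ι ℝ).sum_repr (u x)]
    simp
  simp_rw [hexpand, Finset.sum_mul, ← Finset.sum_add_distrib]
  rw [integral_finsetSum _ fun i _ ↦ by exact (hint₁ i).add (hint₂ i)]
  exact Finset.sum_eq_zero fun i _ ↦ hparts i

/-- Lemma 6.1 in interior, compactly supported form (`b(u,u,u) = 0` in the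
EMAC formulation): for a compactly supported `C¹` vector field `u` on `ℝᵈ`,
`∫ [⟨2𝔻(u)u, u⟩ + (div u)·‖u‖²] = 0`, where `𝔻(u)` is the symmetric strain
tensor; equivalently `∫ [2⟨Du(u), u⟩ + (div u)·‖u‖²] = 0`. -/
theorem stmt_9 (d : ℕ) (hd : 1 ≤ d)
    (u : EuclideanSpace ℝ (Fin d) → EuclideanSpace ℝ (Fin d))
    (hu : ContDiff ℝ 1 u) (hus : HasCompactSupport u) :
    ((∫ x, (⟪((2 : ℝ) • ((1 / 2 : ℝ) • (fderiv ℝ u x +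
              ContinuousLinearMap.adjoint (fderiv ℝ u x)))) (u x), u x⟫ +
          (∑ i : Fin d, fderiv ℝ u x (EuclideanSpace.single i 1) i) * ‖u x‖ ^ 2))
        = 0) ∧
    ((∫ x, (2 * ⟪fderiv ℝ u x (u x), u x⟫ +
          (∑ i : Fin d, fderiv ℝ u x (EuclideanSpace.single i 1) i) * ‖u x‖ ^ 2))
        = 0) := by
  have hsecond : ∫ x, (2 * ⟪fderiv ℝ u x (u x), u x⟫ +
      (∑ i : Fin d, fderiv ℝ u x (EuclideanSpace.single i 1) i) * ‖u x‖ ^ 2) = 0 := by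
    rw [← integral_fderiv_apply_add_divergence_mul_eq_zero hu hus (hu.norm_sq ℝ)]
    congr with x
    rw [(hu.differentiable one_ne_zero x).hasFDerivAt.norm_sq.fderiv]
    simp [real_inner_comm]
  refine ⟨?_, hsecond⟩
  rw [← hsecond]
  congr with x
  simp only [one_div, smul_inv_smul₀ (two_ne_zero' ℝ), add_apply,
    inner_add_left, ContinuousLinearMap.adjoint_inner_left, real_inner_comm, two_mul]
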